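/- Let d,d_Z,T ∈ ℕ, let μ_φ: ℝ^{dT} → ℝ^{d_Z T}, σ_φ: ℝ^{dT} → ℝ^{d_Z T} and De_θ: ℝ^{d_Z T} → ℝ^{dT} be causal maps, let X ∼ μ_data with finite first moment and ε ∼ N(0, I_{d_Z T}) independent of X, set Z = μ_φ(X) + σ_φ(X)⊙ε with law μ_latent, Y = De_θ(Z) with law μ_rec, let μ_prior be a probability measure on ℝ^{d_Z T} and μ_gen = (De_θ)_#μ_prior. If μ_rec and μ_gen are supported in B₁ = {x ∈ ℝ^{dT} : ‖x‖ ≤ 1} (with ‖x‖ = Σ_{t=1}^T ‖x_t‖_{ℝ^d}), then CW₁(μ_data, μ_gen) ≤ 𝓛_rec + C·√((1/2)·D_KL(μ_latent | μ_prior)), where 𝓛_rec = E[‖X − Y‖] and C = 2(2^T − 1). -/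

import Mathlib

open MeasureTheory ProbabilityTheory ENNReal

noncomputable section

/-- The path space `ℝ^{dT}`: paths of length `T` with values in `ℝ^d`. -/
abbrev TPath (d T : ℕ) := Fin T → Fin d → ℝ

/-- Euclidean norm on `ℝ^d`. -/
def eNorm {d : ℕ} (v : Fin d → ℝ) : ℝ := Real.sqrt (∑ i, (v i) ^ 2)

/-- The norm `‖x‖ = ∑_{t=1}^T ‖x_t‖_{ℝ^d}` on the path space. -/
def pathNorm {d T : ℕ} (x : TPath d T) : ℝ := ∑ t, eNorm (x t)

/-- The truncated history `x_{1:t}` of a path, encoded by zeroing out coordinates after time `t`. -/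
def hist {d T : ℕ} (t : ℕ) (x : TPath d T) : TPath d T :=
  fun s => if (s : ℕ) < t then x s else 0

/-- `π` is a coupling of `μ` and `ν`. -/
def IsCoupling {d₁ d₂ T : ℕ} (μ : Measure (TPath d₁ T)) (ν : Measure (TPath d₂ T))
    (π : Measure (TPath d₁ T × TPath d₂ T)) : Prop :=
  π.map Prod.fst = μ ∧ π.map Prod.snd = ν

/-- A coupling `π` is causal: for every `t`, the conditional law of `y_{1:t}` given the full
path `x` depends only on `x_{1:t}`, expressed via conditional expectations of bounded
measurable functions of `y_{1:t}`. -/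
def IsCausalCoupling {d₁ d₂ T : ℕ} (π : Measure (TPath d₁ T × TPath d₂ T)) : Prop :=
  ∀ t : ℕ, t < T → ∀ f : TPath d₂ T → ℝ, Measurable f → (∀ y, f (hist t y) = f y) →
    (∃ C, ∀ y, |f y| ≤ C) →
    π[(fun p => f p.2) | MeasurableSpace.comap Prod.fst inferInstance]
      =ᵐ[π] π[(fun p => f p.2) | MeasurableSpace.comap (fun p => hist t p.1) inferInstance]

/-- A coupling is bicausal if both it and its coordinate swap are causal. -/
def IsBicausalCoupling {d T : ℕ} (π : Measure (TPath d T × TPath d T)) : Prop :=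
  IsCausalCoupling π ∧ IsCausalCoupling (π.map Prod.swap)

/-- Causal (first order) Wasserstein distance `CW₁`. -/
def CW1 {d T : ℕ} (μ ν : Measure (TPath d T)) : ℝ :=
  sInf { r | ∃ π : Measure (TPath d T × TPath d T), IsCoupling μ ν π ∧ IsCausalCoupling π ∧
    r = ∫ p, pathNorm (p.1 - p.2) ∂π }

/-- Adapted (first order) Wasserstein distance `AW₁`. -/
def AW1 {d T : ℕ} (μ ν : Measure (TPath d T)) : ℝ :=
  sInf { r | ∃ π : Measure (TPath d T × TPath d T), IsCoupling μ ν π ∧ IsBicausalCoupling π ∧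
    r = ∫ p, pathNorm (p.1 - p.2) ∂π }

/-- Total variation `TV₀`. -/
def TV0 {d T : ℕ} (μ ν : Measure (TPath d T)) : ℝ :=
  sInf { r | ∃ π : Measure (TPath d T × TPath d T), IsCoupling μ ν π ∧
    r = (π {p | p.1 ≠ p.2}).toReal }

/-- Adapted total variation `AV₀`. -/
def AV0 {d T : ℕ} (μ ν : Measure (TPath d T)) : ℝ :=
  sInf { r | ∃ π : Measure (TPath d T × TPath d T), IsCoupling μ ν π ∧ IsBicausalCoupling π ∧
    r = (π {p | p.1 ≠ p.2}).toReal }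

open Classical in
/-- Kullback–Leibler divergence, valued in `ℝ≥0∞`. -/
def KLDiv {E : Type*} [MeasurableSpace E] (μ ν : Measure E) : ℝ≥0∞ :=
  if μ ≪ ν ∧ Integrable (llr μ ν) μ then ENNReal.ofReal (∫ x, llr μ ν x ∂μ) else ⊤

/-- A map between path spaces is causal if its `t`-th coordinate depends only on `x_{1:t}`,
with Borel-measurability. -/
def IsCausalMap {d₁ d₂ T : ℕ} (𝒯 : TPath d₁ T → TPath d₂ T) : Prop :=
  Measurable 𝒯 ∧
    ∀ (t : Fin T) (x x' : TPath d₁ T), (∀ s : Fin T, s ≤ t → x s = x' s) → 𝒯 x t = 𝒯 x' t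

/-- Standard Gaussian measure `N(0, I_{d_Z T})`. -/
def stdGaussian (dZ T : ℕ) : Measure (TPath dZ T) :=
  Measure.pi fun _ : Fin T => Measure.pi fun _ : Fin dZ => gaussianReal 0 1

/-- **Pinsker's inequality**, evaluated on an event. -/
theorem two_mul_sq_real_sub_real_le_integral_llr {E : Type*} [MeasurableSpace E]
    {μ ν : Measure E} [IsProbabilityMeasure μ] [IsProbabilityMeasure ν]
    (hac : μ ≪ ν) (hint : Integrable (llr μ ν) μ) {A : Set E} (hA : MeasurableSet A) :
    2 * (μ.real A - ν.real A) ^ 2 ≤ ∫ x, llr μ ν x ∂μ := by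
  set p := μ.real A
  set q := ν.real A
  set l : ℝ := 4 * (p - q) with hl
  let X : E → ℝ := A.indicator 1
  have hXm : Measurable X := measurable_one.indicator hA
  have hXb : ∀ x, X x ∈ Set.Icc (0 : ℝ) 1 := fun x => by
    by_cases hx : x ∈ A <;> simp [X, hx]
  have hXν : ∫ x, X x ∂ν = q := integral_indicator_one hA
  have hXμ : ∫ x, X x ∂μ = p := integral_indicator_one hA
  have hXint : Integrable X μ := Integrable.of_mem_Icc 0 1 hXm.aemeasurable (ae_of_all _ hXb)
  have hsub := hasSubgaussianMGF_of_mem_Icc (μ := ν) hXm.aemeasurable (ae_of_all _ hXb)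
  rw [hXν] at hsub
  have hexp : Integrable (fun x => Real.exp (l * (X x - q))) ν := hsub.integrable_exp_mul l
  have hmgf : ∫ x, Real.exp (l * (X x - q)) ∂ν ≤ Real.exp (l ^ 2 / 8) := by
    refine (hsub.mgf_le l).trans (le_of_eq ?_)
    congr 1
    simp
    ring
  have hpos : 0 < ∫ x, Real.exp (l * (X x - q)) ∂ν := integral_exp_pos hexp
  have hlog : Real.log (∫ x, Real.exp (l * (X x - q)) ∂ν) ≤ l ^ 2 / 8 := by
    rw [Real.log_le_iff_le_exp hpos]
    exact hmgf
  have hfint : Integrable (fun x => l * (X x - q)) μ :=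
    (hXint.sub (integrable_const q)).const_mul l
  have : IsProbabilityMeasure (ν.tilted fun x => l * (X x - q)) := isProbabilityMeasure_tilted hexp
  have hnn := InformationTheory.integral_llr_add_sub_measure_univ_nonneg
    (hac.trans (absolutelyContinuous_tilted hexp))
    (integrable_llr_tilted_right hac hfint hint hexp)
  have htilt := integral_llr_tilted_right hac hfint hexp hint
  have hlin : ∫ x, l * (X x - q) ∂μ = l * (p - q) := by
    rw [integral_const_mul, integral_sub hXint (integrable_const q), hXμ]
    simp
  simp only [probReal_univ] at hnn
  rw [htilt, hlin] at hnn
  have : l * (p - q) = 4 * (p - q) ^ 2 := by rw [hl]; ring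
  have : l ^ 2 / 8 = 2 * (p - q) ^ 2 := by rw [hl]; ring
  linarith

/-- **Pinsker's inequality** in additive form. -/
theorem measure_le_add_of_integral_llr {E : Type*} [MeasurableSpace E]
    {μ ν : Measure E} [IsProbabilityMeasure μ] [IsProbabilityMeasure ν]
    (hac : μ ≪ ν) (hint : Integrable (llr μ ν) μ) {A : Set E} (hA : MeasurableSet A) :
    μ A ≤ ν A + (2⁻¹ * ENNReal.ofReal (∫ x, llr μ ν x ∂μ)) ^ (2⁻¹ : ℝ) := by
  have h := two_mul_sq_real_sub_real_le_integral_llr hac hint hA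
  have hnn : 0 ≤ ∫ x, llr μ ν x ∂μ := le_trans (by positivity) h
  have hle : μ.real A ≤ ν.real A + √(2⁻¹ * ∫ x, llr μ ν x ∂μ) := by
    have := Real.le_sqrt_of_sq_le (x := μ.real A - ν.real A)
      (y := 2⁻¹ * ∫ x, llr μ ν x ∂μ) (by linarith)
    linarith
  have h2 : (2⁻¹ * ENNReal.ofReal (∫ x, llr μ ν x ∂μ)) ^ (2⁻¹ : ℝ)
      = ENNReal.ofReal (√(2⁻¹ * ∫ x, llr μ ν x ∂μ)) := by
    rw [Real.sqrt_eq_rpow, ← one_div, ← ENNReal.ofReal_rpow_of_nonneg (by positivity) (by norm_num),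
      ENNReal.ofReal_mul (by norm_num), ENNReal.ofReal_inv_of_pos (by norm_num)]
    norm_num
  rw [h2, ← ofReal_measureReal (μ := μ) (s := A), ← ofReal_measureReal (μ := ν) (s := A),
    ← ENNReal.ofReal_add (by positivity) (by positivity)]
  exact ENNReal.ofReal_le_ofReal hle

section Hist

variable {d T : ℕ}

theorem measurable_hist (t : ℕ) : Measurable (hist t : TPath d T → TPath d T) := by
  refine measurable_pi_lambda _ fun s => ?_
  by_cases h : (s : ℕ) < t
  · simpa [hist, h] using measurable_pi_apply s
  · simp [hist, h]

theorem hist_hist (s t : ℕ) (x : TPath d T) : hist s (hist t x) = hist (min s t) x := by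
  ext r i
  by_cases h : (r : ℕ) < s <;> by_cases h' : (r : ℕ) < t <;> simp [hist, h, h']

theorem hist_hist_of_le {s t : ℕ} (h : s ≤ t) (x : TPath d T) :
    hist s (hist t x) = hist s x := by
  rw [hist_hist, min_eq_left h]

theorem hist_zero (x : TPath d T) : hist 0 x = 0 := by
  ext r i
  simp [hist]

theorem hist_length (x : TPath d T) : hist T x = x := by
  ext r i
  simp [hist]

theorem update_hist_eq_hist_succ (t : Fin T) (x : TPath d T) :
    Function.update (hist t x) t (x t) = hist (t + 1) x := by
  ext r i
  by_cases h : r = t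
  · subst h; simp [hist]
  · have : (r : ℕ) < t + 1 ↔ (r : ℕ) < t := by
      have : (r : ℕ) ≠ t := fun h' => h (Fin.ext h')
      omega
    simp [hist, Function.update_of_ne h, this]

theorem hist_succ_update_hist (t : Fin T) (x : TPath d T) (e : Fin d → ℝ) :
    hist (t + 1) (Function.update (hist t x) t e) = Function.update (hist t x) t e := by
  ext r i
  by_cases h : r = t
  · subst h; simp [hist]
  · by_cases h' : (r : ℕ) < t
    · simp [hist, Function.update_of_ne h, h', h'.trans (Nat.lt_succ_self _)]
    · simp [hist, Function.update_of_ne h, h']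

theorem hist_update_hist (t : Fin T) (x : TPath d T) (e : Fin d → ℝ) :
    hist t (Function.update (hist t x) t e) = hist t x := by
  ext r i
  by_cases h : r = t
  · subst h; simp [hist]
  · by_cases h' : (r : ℕ) < t <;> simp [hist, Function.update_of_ne h, h']

theorem map_hist_map_hist {s t : ℕ} (h : s ≤ t) (m : Measure (TPath d T)) :
    (m.map (hist t)).map (hist s) = m.map (hist s) := by
  rw [Measure.map_map (measurable_hist s) (measurable_hist t)]
  congr 1
  exact funext fun x => hist_hist_of_le h x

/-- A finite measure on paths can be sampled one time step ahead, from the history up to `t` to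
the history up to `t + 1`, by a kernel which keeps the history up to `t`. -/
theorem exists_kernel_hist_succ (t : Fin T) (σ : Measure (TPath d T)) [IsFiniteMeasure σ] :
    ∃ θ : Kernel (TPath d T) (TPath d T), IsMarkovKernel θ ∧
      θ ∘ₘ (σ.map (hist t)) = σ.map (hist (t + 1)) ∧
      (∀ w, (θ w).map (hist (t + 1)) = θ w) ∧
      ∀ w, (θ w).map (hist t) = Measure.dirac (hist t w) := by
  let κ : Kernel (TPath d T) (Fin d → ℝ) := condDistrib (fun w => w t) (hist t) σ
  let u : TPath d T × (Fin d → ℝ) → TPath d T := fun p => Function.update (hist t p.1) t p.2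
  have hu : Measurable u := by
    refine measurable_pi_lambda _ fun s => ?_
    by_cases h : s = t
    · subst h
      simpa [u] using measurable_snd
    · simpa [u, Function.update_of_ne h, Function.comp_def] using
        (measurable_pi_apply s).comp ((measurable_hist t).comp measurable_fst)
  have hu' : ∀ w, Measurable fun e => u (w, e) := fun w => hu.comp measurable_prodMk_left
  have happ : ∀ w, ((Kernel.id ×ₖ κ).map u) w = (κ w).map fun e => u (w, e) := fun w => by
    rw [Kernel.map_apply _ hu, Kernel.prod_apply, Kernel.id_apply, Measure.dirac_prod,
      Measure.map_map hu measurable_prodMk_left]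
    rfl
  refine ⟨(Kernel.id ×ₖ κ).map u, Kernel.IsMarkovKernel.map _ hu, ?_, fun w => ?_, fun w => ?_⟩
  · rw [← Measure.map_comp _ _ hu, ← Measure.compProd_eq_comp_prod,
      compProd_map_condDistrib (measurable_pi_apply t).aemeasurable,
      Measure.map_map hu ((measurable_hist t).prodMk (measurable_pi_apply t))]
    congr 1
    ext1 w
    simp only [u, Function.comp, hist_hist_of_le le_rfl]
    exact update_hist_eq_hist_succ t w
  · rw [happ, Measure.map_map (measurable_hist _) (hu' w)]
    congr 1
    exact funext fun e => hist_succ_update_hist t w e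
  · rw [happ, Measure.map_map (measurable_hist _) (hu' w)]
    have : hist t ∘ (fun e => u (w, e)) = fun _ => hist t w :=
      funext fun e => hist_update_hist t w e
    rw [this, Measure.map_const]
    simp

end Hist

section WeightedDirac

variable {α β γ : Type*} [MeasurableSpace α] [MeasurableSpace β] [MeasurableSpace γ]

/-- The kernel sending `a` to the Dirac mass at `f a` with weight `c a`. -/
def weightedDirac (c : α → ℝ≥0∞) (f : α → β) (hc : Measurable c) (hf : Measurable f) :
    Kernel α β where
  toFun a := c a • Measure.dirac (f a)
  measurable' := by
    refine Measure.measurable_of_measurable_coe _ fun s hs => ?_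
    simp only [Measure.smul_apply, smul_eq_mul, Measure.dirac_apply' _ hs]
    exact hc.mul ((measurable_one.indicator hs).comp hf)

theorem weightedDirac_apply {c : α → ℝ≥0∞} {f : α → β} (hc : Measurable c) (hf : Measurable f)
    (a : α) : weightedDirac c f hc hf a = c a • Measure.dirac (f a) := rfl

theorem weightedDirac_comp {c : α → ℝ≥0∞} {f : α → β} (hc : Measurable c) (hf : Measurable f)
    (μ : Measure α) : weightedDirac c f hc hf ∘ₘ μ = (μ.withDensity c).map f := by
  ext s hs
  rw [Measure.bind_apply hs (Kernel.aemeasurable _), Measure.map_apply hf hs,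
    withDensity_apply _ (hf hs), ← lintegral_indicator (hf hs)]
  refine lintegral_congr fun a => ?_
  by_cases h : f a ∈ s <;> simp [weightedDirac_apply, Measure.dirac_apply' _ hs, h]

end WeightedDirac

theorem measure_add_right_cancel {α : Type*} [MeasurableSpace α] {m₁ m₂ m : Measure α}
    [IsFiniteMeasure m] (h : m₁ + m = m₂ + m) : m₁ = m₂ := by
  ext s _
  have := congrArg (fun k => k s) h
  simpa [ENNReal.add_left_inj (measure_ne_top m s)] using this

/-- Given adapted survival probabilities `S t`, decreasing in `t`, whose surviving mass is dominated
by `ν`, there are kernels describing the part of the mass which does not survive, and completing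
the surviving part to a causal transport from `μ` to `ν`. -/
theorem exists_complementary_kernel {d T : ℕ} (μ ν : Measure (TPath d T)) [IsProbabilityMeasure μ]
    [IsProbabilityMeasure ν] (S : ℕ → TPath d T → ℝ≥0∞) (hSm : ∀ t, Measurable (S t))
    (hS0 : ∀ z, S 0 z = 1) (hSanti : ∀ t z, S (t + 1) z ≤ S t z)
    (hSh : ∀ t z, S t (hist t z) = S t z)
    (hdom : ∀ t, (μ.withDensity (S t)).map (hist t) ≤ ν.map (hist t)) (t : ℕ) (ht : t ≤ T) :
    ∃ D : Kernel (TPath d T) (TPath d T),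
      (∀ z, D z = D (hist t z)) ∧ (∀ z, (D z).map (hist t) = D z) ∧
      (∀ z, D z Set.univ + S t z = 1) ∧
      D ∘ₘ μ + (μ.withDensity (S t)).map (hist t) = ν.map (hist t) ∧
      ∀ s ≤ t, ∀ z, (D z + S t z • Measure.dirac (hist t z)).map (hist s) =
        (D (hist s z) + S t (hist s z) • Measure.dirac (hist t (hist s z))).map (hist s) := by
  have hfin : ∀ t, IsFiniteMeasure ((μ.withDensity (S t)).map (hist t)) := fun t =>
    isFiniteMeasure_of_le _ (hdom t)
  induction t with
  | zero =>
    have h0 : (hist 0 : TPath d T → TPath d T) = fun _ => 0 := funext hist_zero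
    have hS : S 0 = 1 := funext hS0
    refine ⟨0, by simp, by simp, by simp [hS0], ?_, ?_⟩
    · simp [h0, hS, Measure.map_const]
    · intro s hs z
      simp [hS, h0]
  | succ t ih =>
    obtain ⟨D, hDh, hDmap, hDuniv, hDμ, hDc⟩ := ih (Nat.le_of_succ_le ht)
    have hmt := measurable_hist (d := d) (T := T) t
    have hms := measurable_hist (d := d) (T := T) (t + 1)
    let A := ν.map (hist (t + 1))
    let B := (μ.withDensity (S (t + 1))).map (hist (t + 1))
    have hB : IsFiniteMeasure B := hfin (t + 1)
    let σ := A - B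
    have hσ : σ + B = A := Measure.sub_add_cancel_of_le (hdom (t + 1))
    have hσfin : IsFiniteMeasure σ := isFiniteMeasure_of_le A Measure.sub_le
    obtain ⟨θ, hθM, hθσ, hθs, hθt⟩ := exists_kernel_hist_succ ⟨t, ht⟩ σ
    simp only at hθσ hθs hθt
    have hdiff : Measurable fun z => S t z - S (t + 1) z := (hSm t).sub (hSm (t + 1))
    let R := D + weightedDirac (fun z => S t z - S (t + 1) z) (hist t) hdiff hmt
    have hR : ∀ z, R z = D z + (S t z - S (t + 1) z) • Measure.dirac (hist t z) := fun z => rfl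
    have hRmap : ∀ z, (R z).map (hist t) = R z := fun z => by
      rw [hR, Measure.map_add _ _ hmt, hDmap, Measure.map_smul, Measure.map_dirac' hmt,
        hist_hist_of_le le_rfl]
    have hBt : B.map (hist t) = (μ.withDensity (S (t + 1))).map (hist t) :=
      map_hist_map_hist (Nat.le_succ t) _
    have hRμ : R ∘ₘ μ = σ.map (hist t) := by
      refine measure_add_right_cancel (m := B.map (hist t)) ?_
      rw [← Measure.map_add _ _ hmt, hσ, show A.map (hist t) = ν.map (hist t) from
        map_hist_map_hist (Nat.le_succ t) ν, ← hDμ, hBt]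
      have hadd : R ∘ₘ μ = D ∘ₘ μ +
          (μ.withDensity fun z => S t z - S (t + 1) z).map (hist t) := by
        rw [← weightedDirac_comp hdiff hmt]
        exact Measure.add_comp
      have hS : (fun z => S t z - S (t + 1) z) + S (t + 1) = S t :=
        funext fun z => tsub_add_cancel_of_le (hSanti t z)
      rw [hadd, add_assoc, ← Measure.map_add _ _ hmt, ← withDensity_add_left hdiff, hS]
    have hcomp : ∀ z, (θ ∘ₖ R) z = θ ∘ₘ (R z) := fun z => Kernel.comp_apply _ _ _
    have hθRs : ∀ z, (θ ∘ₘ (R z)).map (hist (t + 1)) = θ ∘ₘ (R z) := fun z => by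
      rw [Measure.map_comp _ _ hms]
      exact Measure.comp_congr (ae_of_all _ fun w => by rw [Kernel.map_apply _ hms, hθs])
    have hθRt : ∀ z, (θ ∘ₘ (R z)).map (hist t) = R z := fun z => by
      rw [Measure.map_comp _ _ hmt]
      conv_rhs => rw [← hRmap z, ← Measure.deterministic_comp_eq_map hmt]
      exact Measure.comp_congr (ae_of_all _ fun w => by
        rw [Kernel.map_apply _ hmt, hθt, Kernel.deterministic_apply])
    have hadapt : ∀ z, R z = R (hist (t + 1) z) := fun z => by
      have h1 : S t (hist (t + 1) z) = S t z := by
        rw [← hSh t, hist_hist_of_le (Nat.le_succ t), hSh]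
      rw [hR, hR, hSh, h1, hist_hist_of_le (Nat.le_succ t), hDh z, hDh (hist (t + 1) z),
        hist_hist_of_le (Nat.le_succ t)]
    have hproj : ∀ z, (θ ∘ₘ (R z) + S (t + 1) z • Measure.dirac (hist (t + 1) z)).map (hist t) =
        D z + S t z • Measure.dirac (hist t z) := fun z => by
      rw [Measure.map_add _ _ hmt, hθRt, Measure.map_smul, Measure.map_dirac' hmt,
        hist_hist_of_le (Nat.le_succ t), hR, add_assoc, ← add_smul,
        tsub_add_cancel_of_le (hSanti t z)]
    refine ⟨θ ∘ₖ R, fun z => ?_, fun z => ?_, fun z => ?_, ?_, fun s hs z => ?_⟩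
    · rw [hcomp, hcomp, ← hadapt]
    · rw [hcomp, hθRs]
    · rw [hcomp, Measure.bind_apply MeasurableSet.univ θ.aemeasurable]
      simp only [measure_univ, lintegral_const, one_mul]
      rw [← hDuniv z, hR]
      simp [add_assoc, tsub_add_cancel_of_le (hSanti t z)]
    · rw [← Measure.comp_assoc, hRμ, hθσ]
      change σ.map (hist (t + 1)) + B = A
      have hAmap : A.map (hist (t + 1)) = A := map_hist_map_hist le_rfl _
      have hBmap : B.map (hist (t + 1)) = B := map_hist_map_hist le_rfl _
      conv_lhs => rw [← hBmap]
      rw [← Measure.map_add _ _ hms, hσ, hAmap]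
    · rw [hcomp, hcomp]
      rcases Nat.lt_or_ge t s with hlt | hle
      · obtain rfl : s = t + 1 := by omega
        rw [← hadapt, hSh, hist_hist_of_le le_rfl]
      · rw [← map_hist_map_hist hle, hproj, hDc s hle, ← hproj, map_hist_map_hist hle]
section Survival

variable {E : Type*} [MeasurableSpace E] {μ ν : Measure E}

theorem measurable_inv_rnDeriv (μ ν : Measure E) : Measurable fun x => (μ.rnDeriv ν x)⁻¹ :=
  (Measure.measurable_rnDeriv μ ν).inv

theorem lintegral_inv_rnDeriv_le [SigmaFinite μ] [SigmaFinite ν] (hac : μ ≪ ν) {s : Set E}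
    (hs : MeasurableSet s) : ∫⁻ x in s, (μ.rnDeriv ν x)⁻¹ ∂μ ≤ ν s := by
  have hinv := measurable_inv_rnDeriv μ ν
  calc ∫⁻ x in s, (μ.rnDeriv ν x)⁻¹ ∂μ
      = ∫⁻ x in s, μ.rnDeriv ν x * (μ.rnDeriv ν x)⁻¹ ∂ν :=
        (setLIntegral_rnDeriv_mul hac hinv.aemeasurable hs).symm
    _ ≤ ∫⁻ _ in s, 1 ∂ν := lintegral_mono fun x => ENNReal.mul_inv_le_one _
    _ = ν s := by simp

theorem lintegral_one_sub_inv_rnDeriv_le [IsFiniteMeasure μ] [IsFiniteMeasure ν] (hac : μ ≪ ν)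
    {δ : ℝ≥0∞} (hδ : ∀ A, MeasurableSet A → μ A ≤ ν A + δ) :
    ∫⁻ x, (1 - (μ.rnDeriv ν x)⁻¹) ∂μ ≤ δ := by
  have hm := Measure.measurable_rnDeriv μ ν
  have hinv := measurable_inv_rnDeriv μ ν
  set A := {x | 1 < μ.rnDeriv ν x} with hAdef
  have hA : MeasurableSet A := measurableSet_lt measurable_const hm
  have hrestr : ∫⁻ x, (1 - (μ.rnDeriv ν x)⁻¹) ∂μ = ∫⁻ x in A, (1 - (μ.rnDeriv ν x)⁻¹) ∂μ := by
    rw [← lintegral_indicator hA]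
    refine lintegral_congr fun x => ?_
    by_cases hx : x ∈ A
    · simp [hx]
    · have : μ.rnDeriv ν x ≤ 1 := not_lt.1 hx
      simp [hx, tsub_eq_zero_of_le (ENNReal.one_le_inv.2 this)]
  have hν : ν A = ∫⁻ x in A, (μ.rnDeriv ν x)⁻¹ ∂μ := by
    rw [← setLIntegral_rnDeriv_mul hac hinv.aemeasurable hA, ← setLIntegral_one]
    refine setLIntegral_congr_fun_ae hA ?_
    filter_upwards [Measure.rnDeriv_lt_top μ ν] with x hx hxA
    exact (ENNReal.mul_inv_cancel (zero_lt_one.trans hxA).ne' hx.ne).symm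
  have hsum : ∫⁻ x in A, (1 - (μ.rnDeriv ν x)⁻¹) ∂μ + ν A = μ A := by
    rw [hν, ← lintegral_add_right _ hinv, ← setLIntegral_one]
    refine setLIntegral_congr_fun hA fun x hx => ?_
    exact tsub_add_cancel_of_le (ENNReal.inv_le_one.2 (le_of_lt hx))
  rw [hrestr]
  refine (ENNReal.add_le_add_iff_right (measure_ne_top ν A)).1 ?_
  rw [hsum, add_comm]
  exact hδ A hA

/-- The probability, given the path, that mass is kept in place up to time `t`: the inverse of the
running maximum of the density of `μ` with respect to `ν` on histories. -/
def survival {d T : ℕ} (μ ν : Measure (TPath d T)) : ℕ → TPath d T → ℝ≥0∞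
  | 0, _ => 1
  | t + 1, z => min (survival μ ν t z)
      ((μ.map (hist (t + 1))).rnDeriv (ν.map (hist (t + 1))) (hist (t + 1) z))⁻¹

variable {d T : ℕ} {μ ν : Measure (TPath d T)}

theorem measurable_survival (t : ℕ) : Measurable (survival μ ν t) := by
  induction t with
  | zero => exact measurable_const
  | succ t ih =>
    exact ih.min ((Measure.measurable_rnDeriv _ _).comp (measurable_hist (t + 1))).inv

theorem survival_hist {s t : ℕ} (h : t ≤ s) (z : TPath d T) :
    survival μ ν t (hist s z) = survival μ ν t z := by
  induction t with
  | zero => rfl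
  | succ t ih =>
    rw [survival, survival, ih (Nat.le_of_succ_le h), hist_hist_of_le h]

theorem map_withDensity_survival_le [IsProbabilityMeasure μ] [IsProbabilityMeasure ν]
    (hac : μ ≪ ν) (t : ℕ) :
    (μ.withDensity (survival μ ν t)).map (hist t) ≤ ν.map (hist t) := by
  have hm := measurable_hist (d := d) (T := T) t
  cases t with
  | zero =>
    have h0 : (hist 0 : TPath d T → TPath d T) = fun _ => 0 := funext hist_zero
    have h1 : survival μ ν 0 = 1 := rfl
    simp [h0, h1, Measure.map_const]
  | succ t =>
    have := Measure.isProbabilityMeasure_map (μ := μ) hm.aemeasurable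
    have := Measure.isProbabilityMeasure_map (μ := ν) hm.aemeasurable
    refine Measure.le_iff.2 fun s hs => ?_
    rw [Measure.map_apply hm hs, withDensity_apply _ (hm hs)]
    refine le_trans ?_ (lintegral_inv_rnDeriv_le (hac.map hm) hs)
    rw [setLIntegral_map hs (measurable_inv_rnDeriv _ _) hm]
    exact lintegral_mono fun z => min_le_right _ _

theorem lintegral_one_sub_survival_le [IsProbabilityMeasure μ] [IsProbabilityMeasure ν]
    (hac : μ ≪ ν) {δ : ℝ≥0∞} (hδ : ∀ A, MeasurableSet A → μ A ≤ ν A + δ) (t : ℕ) :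
    ∫⁻ z, (1 - survival μ ν t z) ∂μ ≤ t * δ := by
  induction t with
  | zero => simp [survival]
  | succ t ih =>
    have hm := measurable_hist (d := d) (T := T) (t + 1)
    have := Measure.isProbabilityMeasure_map (μ := μ) hm.aemeasurable
    have := Measure.isProbabilityMeasure_map (μ := ν) hm.aemeasurable
    have hstep := lintegral_one_sub_inv_rnDeriv_le (hac.map hm) (δ := δ) fun A hA => by
      rw [Measure.map_apply hm hA, Measure.map_apply hm hA]
      exact hδ _ (hm hA)
    rw [lintegral_map (Measurable.const_sub (measurable_inv_rnDeriv _ _) 1) hm] at hstep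
    calc ∫⁻ z, (1 - survival μ ν (t + 1) z) ∂μ
        ≤ ∫⁻ z, ((1 - survival μ ν t z) + (1 - ((μ.map (hist (t + 1))).rnDeriv
            (ν.map (hist (t + 1))) (hist (t + 1) z))⁻¹)) ∂μ := by
          refine lintegral_mono fun z => ?_
          rw [survival]
          rcases min_choice (survival μ ν t z) ((μ.map (hist (t + 1))).rnDeriv
            (ν.map (hist (t + 1))) (hist (t + 1) z))⁻¹ with h | h <;> rw [h]
          · exact le_self_add
          · exact le_add_self
      _ ≤ t * δ + δ := by
          rw [lintegral_add_left ((measurable_survival t).const_sub 1)]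
          exact add_le_add ih hstep
      _ = (t + 1 : ℕ) * δ := by push_cast; ring

/-- If `μ A ≤ ν A + δ` on every event, then `μ` can be transported causally to `ν` by a kernel
which moves mass at most `T * δ`. -/
theorem exists_causal_kernel [IsProbabilityMeasure μ] [IsProbabilityMeasure ν]
    (hac : μ ≪ ν) {δ : ℝ≥0∞} (hδ : ∀ A, MeasurableSet A → μ A ≤ ν A + δ) :
    ∃ K D : Kernel (TPath d T) (TPath d T), IsMarkovKernel K ∧ K ∘ₘ μ = ν ∧
      (∀ z, ∃ c : ℝ≥0∞, K z = D z + c • Measure.dirac z) ∧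
      ∫⁻ z, D z Set.univ ∂μ ≤ T * δ ∧
      ∀ s ≤ T, ∀ z, (K z).map (hist s) = (K (hist s z)).map (hist s) := by
  have hid : (hist T : TPath d T → TPath d T) = id := funext hist_length
  obtain ⟨D, -, -, hDuniv, hDμ, hDc⟩ := exists_complementary_kernel μ ν (survival μ ν)
    measurable_survival (fun _ => rfl) (fun _ _ => min_le_left _ _)
    (fun t z => survival_hist le_rfl z) (map_withDensity_survival_le hac) T le_rfl
  simp only [hid, Measure.map_id, id_eq] at hDμ hDc
  let K := D + weightedDirac (survival μ ν T) id (measurable_survival T) measurable_id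
  have hK : ∀ z, K z = D z + survival μ ν T z • Measure.dirac z := fun z => rfl
  refine ⟨K, D, ⟨fun z => ⟨?_⟩⟩, ?_, fun z => ⟨_, hK z⟩, ?_, fun s hs z => ?_⟩
  · rw [hK, ← hDuniv z]
    simp
  · rw [← hDμ]
    refine (Measure.add_comp).trans ?_
    rw [weightedDirac_comp, Measure.map_id]
  · refine le_trans (lintegral_mono fun z => ?_) (lintegral_one_sub_survival_le hac hδ T)
    have hne : survival μ ν T z ≠ ∞ := ne_top_of_le_ne_top one_ne_top
      (le_add_self.trans (hDuniv z).le)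
    exact ENNReal.le_sub_of_add_le_right hne (hDuniv z).le
  · rw [hK, hK]
    exact hDc s hs z

end Survival

section PathNorm

theorem eNorm_eq_norm {d : ℕ} (v : Fin d → ℝ) : eNorm v = ‖WithLp.toLp 2 v‖ := by
  simp [eNorm, EuclideanSpace.norm_eq]

theorem eNorm_add_le {d : ℕ} (v w : Fin d → ℝ) : eNorm (v + w) ≤ eNorm v + eNorm w := by
  simp only [eNorm_eq_norm, WithLp.toLp_add]
  exact norm_add_le _ _

variable {d T : ℕ}

theorem pathNorm_nonneg (x : TPath d T) : 0 ≤ pathNorm x :=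
  Finset.sum_nonneg fun _ _ => Real.sqrt_nonneg _

theorem pathNorm_zero : pathNorm (0 : TPath d T) = 0 := by
  simp [pathNorm, eNorm]

theorem pathNorm_add_le (x y : TPath d T) : pathNorm (x + y) ≤ pathNorm x + pathNorm y := by
  simp only [pathNorm, ← Finset.sum_add_distrib]
  exact Finset.sum_le_sum fun t _ => eNorm_add_le (x t) (y t)

theorem pathNorm_neg (x : TPath d T) : pathNorm (-x) = pathNorm x := by
  simp [pathNorm, eNorm]

theorem pathNorm_sub_le (x y : TPath d T) : pathNorm (x - y) ≤ pathNorm x + pathNorm y := by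
  rw [sub_eq_add_neg, ← pathNorm_neg y]
  exact pathNorm_add_le x (-y)

theorem pathNorm_sub_le_add (x y z : TPath d T) :
    pathNorm (x - z) ≤ pathNorm (x - y) + pathNorm (y - z) := by
  simpa using pathNorm_add_le (x - y) (y - z)

theorem measurable_pathNorm : Measurable (pathNorm : TPath d T → ℝ) := by
  unfold pathNorm eNorm
  fun_prop

end PathNorm

section CausalKernel

variable {d₁ d₂ d₃ T : ℕ}

/-- A kernel between path spaces is causal if the law it gives to the target history up to `t`
depends only on the source history up to `t`. -/
def IsCausalKernel (κ : Kernel (TPath d₁ T) (TPath d₂ T)) : Prop :=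
  ∀ t ≤ T, ∀ x, (κ x).map (hist t) = (κ (hist t x)).map (hist t)

theorem IsCausalKernel.comp {η : Kernel (TPath d₂ T) (TPath d₃ T)}
    {κ : Kernel (TPath d₁ T) (TPath d₂ T)} (hη : IsCausalKernel η) (hκ : IsCausalKernel κ) :
    IsCausalKernel (η ∘ₖ κ) := by
  intro t ht x
  have hm₂ := measurable_hist (d := d₂) (T := T) t
  have hm₃ := measurable_hist (d := d₃) (T := T) t
  have key : ∀ x, ((η ∘ₖ κ) x).map (hist t) = (η.map (hist t)) ∘ₘ ((κ x).map (hist t)) := by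
    intro x
    rw [Kernel.comp_apply, Measure.map_comp _ _ hm₃, ← Measure.deterministic_comp_eq_map hm₂,
      Measure.comp_assoc, Kernel.comp_deterministic_eq_comap]
    refine Measure.comp_congr (ae_of_all _ fun w => ?_)
    rw [Kernel.comap_apply, Kernel.map_apply _ hm₃, Kernel.map_apply _ hm₃]
    exact hη t ht w
  rw [key, key, hκ t ht]

theorem IsCausalMap.hist_apply {F : TPath d₁ T → TPath d₂ T} (hF : IsCausalMap F) (t : ℕ)
    (x : TPath d₁ T) : hist t (F (hist t x)) = hist t (F x) := by
  ext r i
  by_cases h : (r : ℕ) < t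
  · have : F (hist t x) r = F x r := hF.2 r _ _ fun s hs => by
      have : (s : ℕ) < t := lt_of_le_of_lt (Fin.le_def.1 hs) h
      simp [hist, this]
    simp [hist, h, this]
  · simp [hist, h]

theorem IsCausalMap.isCausalKernel_deterministic {F : TPath d₁ T → TPath d₂ T}
    (hF : IsCausalMap F) : IsCausalKernel (Kernel.deterministic F hF.1) := by
  intro t _ x
  rw [Kernel.deterministic_apply, Kernel.deterministic_apply,
    Measure.map_dirac' (measurable_hist t), Measure.map_dirac' (measurable_hist t), hF.hist_apply]

/-- A causal kernel induces a causal coupling. -/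
theorem IsCausalKernel.isCausalCoupling_compProd {κ : Kernel (TPath d₁ T) (TPath d₂ T)}
    [IsMarkovKernel κ] (hκ : IsCausalKernel κ) (μ : Measure (TPath d₁ T))
    [IsProbabilityMeasure μ] : IsCausalCoupling (μ ⊗ₘ κ) := by
  rintro t ht f hf hfh ⟨C, hC⟩
  have hm := measurable_hist (d := d₁) (T := T) t
  have hm₂ := measurable_hist (d := d₂) (T := T) t
  let h : TPath d₁ T → ℝ := fun x => ∫ y, f y ∂κ x
  have hmeas : Measurable h :=
    (StronglyMeasurable.integral_kernel hf.stronglyMeasurable (κ := κ)).measurable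
  have hhist : ∀ x, h (hist t x) = h x := by
    have : ∀ x, h x = ∫ y, f y ∂((κ x).map (hist t)) := fun x => by
      rw [integral_map hm₂.aemeasurable hf.aestronglyMeasurable]
      simp only [hfh, h]
    intro x
    rw [this, this, ← hκ t ht.le]
  have hint : Integrable (fun p : TPath d₁ T × TPath d₂ T => f p.2) (μ ⊗ₘ κ) :=
    Integrable.of_bound (hf.comp measurable_snd).aestronglyMeasurable C
      (ae_of_all _ fun p => hC p.2)
  have hhC : ∀ x, ‖h x‖ ≤ C := fun x => by
    simpa using norm_integral_le_of_norm_le_const (μ := κ x) (f := f) (ae_of_all _ hC)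
  have key : ∀ m : MeasurableSpace (TPath d₁ T × TPath d₂ T),
      m ≤ MeasurableSpace.comap Prod.fst inferInstance →
      Measurable[m] (fun p : TPath d₁ T × TPath d₂ T => h p.1) →
      (fun p => h p.1) =ᵐ[μ ⊗ₘ κ] (μ ⊗ₘ κ)[(fun p => f p.2) | m] := by
    intro m hle hhm
    have hhint : Integrable (fun p : TPath d₁ T × TPath d₂ T => h p.1) (μ ⊗ₘ κ) :=
      Integrable.of_bound (hmeas.comp measurable_fst).aestronglyMeasurable C
        (ae_of_all _ fun p => hhC p.1)
    refine ae_eq_condExp_of_forall_setIntegral_eq (hle.trans measurable_fst.comap_le) hint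
      (fun s _ _ => hhint.integrableOn) (fun s hs _ => ?_) hhm.stronglyMeasurable.aestronglyMeasurable
    obtain ⟨B, hB, rfl⟩ := hle s hs
    rw [← Set.prod_univ, Measure.setIntegral_compProd hB MeasurableSet.univ hhint.integrableOn,
      Measure.setIntegral_compProd hB MeasurableSet.univ hint.integrableOn]
    simp [h]
  have hle : MeasurableSpace.comap (fun p : TPath d₁ T × TPath d₂ T => hist t p.1) inferInstance ≤
      MeasurableSpace.comap Prod.fst inferInstance := by
    rintro _ ⟨B, hB, rfl⟩
    exact ⟨hist t ⁻¹' B, hm hB, rfl⟩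
  refine (key _ le_rfl (hmeas.comp (comap_measurable _))).symm.trans (key _ hle ?_)
  have : (fun p : TPath d₁ T × TPath d₂ T => h p.1) = h ∘ fun p => hist t p.1 :=
    funext fun p => (hhist p.1).symm
  rw [this]
  exact hmeas.comp (comap_measurable _)

/-- The kernel applying a map with an independent noise of law `γ`. -/
def noisyKernel (F : TPath d₁ T × TPath d₂ T → TPath d₃ T) (γ : Measure (TPath d₂ T)) :
    Kernel (TPath d₁ T) (TPath d₃ T) :=
  (Kernel.id ×ₖ Kernel.const _ γ).map F

variable {F : TPath d₁ T × TPath d₂ T → TPath d₃ T} {γ : Measure (TPath d₂ T)}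

theorem noisyKernel_apply [IsProbabilityMeasure γ] (hF : Measurable F) (x : TPath d₁ T) :
    noisyKernel F γ x = γ.map fun e => F (x, e) := by
  rw [noisyKernel, Kernel.map_apply _ hF, Kernel.prod_apply, Kernel.id_apply, Kernel.const_apply,
    Measure.dirac_prod, Measure.map_map hF measurable_prodMk_left]
  rfl

theorem isMarkovKernel_noisyKernel [IsProbabilityMeasure γ] (hF : Measurable F) :
    IsMarkovKernel (noisyKernel F γ) :=
  Kernel.IsMarkovKernel.map _ hF

theorem noisyKernel_comp [IsProbabilityMeasure γ] (hF : Measurable F) (μ : Measure (TPath d₁ T))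
    [SFinite μ] : noisyKernel F γ ∘ₘ μ = (μ.prod γ).map F := by
  rw [noisyKernel, ← Measure.map_comp _ _ hF, ← Measure.compProd_eq_comp_prod,
    Measure.compProd_const]

theorem isCausalKernel_noisyKernel [IsProbabilityMeasure γ] (hF : Measurable F)
    (hcausal : ∀ t x e, hist t (F (hist t x, e)) = hist t (F (x, e))) :
    IsCausalKernel (noisyKernel F γ) := by
  intro t _ x
  have hx : ∀ x, Measurable fun e => F (x, e) := fun x => hF.comp measurable_prodMk_left
  rw [noisyKernel_apply hF, noisyKernel_apply hF, Measure.map_map (measurable_hist t) (hx _),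
    Measure.map_map (measurable_hist t) (hx _)]
  congr 1
  exact funext fun e => (hcausal t x e).symm

theorem lintegral_compProd_noisyKernel [IsProbabilityMeasure γ] (hF : Measurable F)
    (μ : Measure (TPath d₁ T)) [SFinite μ] {g : TPath d₁ T × TPath d₃ T → ℝ≥0∞}
    (hg : Measurable g) :
    ∫⁻ p, g p ∂(μ ⊗ₘ noisyKernel F γ) = ∫⁻ p, g (p.1, F p) ∂(μ.prod γ) := by
  have := isMarkovKernel_noisyKernel (γ := γ) hF
  have hgF : Measurable fun p => g (p.1, F p) := hg.comp (measurable_fst.prodMk hF)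
  rw [Measure.lintegral_compProd hg, lintegral_prod _ hgF.aemeasurable]
  refine lintegral_congr fun x => ?_
  have hgx : Measurable fun w => g (x, w) := hg.comp measurable_prodMk_left
  have hFx : Measurable fun e => F (x, e) := hF.comp measurable_prodMk_left
  rw [noisyKernel_apply hF, lintegral_map hgx hFx]

theorem ofReal_CW1_le {d T : ℕ} {μ ν : Measure (TPath d T)} {π : Measure (TPath d T × TPath d T)}
    (hπ : IsCoupling μ ν π) (hc : IsCausalCoupling π) :
    ENNReal.ofReal (CW1 μ ν) ≤ ∫⁻ p, ENNReal.ofReal (pathNorm (p.1 - p.2)) ∂π := by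
  have hle : CW1 μ ν ≤ ∫ p, pathNorm (p.1 - p.2) ∂π := by
    refine csInf_le ⟨0, ?_⟩ ⟨π, hπ, hc, rfl⟩
    rintro r ⟨π', -, -, rfl⟩
    exact integral_nonneg fun p => pathNorm_nonneg _
  refine (ENNReal.ofReal_le_ofReal hle).trans ?_
  have hm : Measurable fun p : TPath d T × TPath d T => pathNorm (p.1 - p.2) :=
    measurable_pathNorm.comp (measurable_fst.sub measurable_snd)
  rw [integral_eq_lintegral_of_nonneg_ae (ae_of_all _ fun p => pathNorm_nonneg _)
    hm.aestronglyMeasurable]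
  exact ENNReal.ofReal_toReal_le

end CausalKernel

section DecodedChain

variable {α β γ δ : Type*} [MeasurableSpace α] [MeasurableSpace β] [MeasurableSpace γ]
  [MeasurableSpace δ]

theorem measurable_lintegral_decode (K : Kernel β γ) [IsMarkovKernel K] {De : γ → δ}
    (hDe : Measurable De) {c : α × δ → ℝ≥0∞} (hc : Measurable c) :
    Measurable fun q : α × β => ∫⁻ w, c (q.1, De w) ∂K q.2 := by
  have : Measurable fun q : (α × β) × γ => c (q.1.1, De q.2) := by fun_prop
  exact this.lintegral_kernel_prod_right' (κ := K.comap Prod.snd measurable_snd)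

/-- Integrating against a measure composed with a decoded chain of two kernels. -/
theorem lintegral_compProd_deterministic_comp (μ : Measure α) [SFinite μ]
    (J : Kernel α β) [IsMarkovKernel J] (K : Kernel β γ) [IsMarkovKernel K] {De : γ → δ}
    (hDe : Measurable De) {c : α × δ → ℝ≥0∞} (hc : Measurable c) :
    ∫⁻ p, c p ∂(μ ⊗ₘ (Kernel.deterministic De hDe ∘ₖ (K ∘ₖ J))) =
      ∫⁻ q, ∫⁻ w, c (q.1, De w) ∂K q.2 ∂(μ ⊗ₘ J) := by
  rw [Measure.lintegral_compProd hc,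
    Measure.lintegral_compProd (measurable_lintegral_decode K hDe hc)]
  refine lintegral_congr fun x => ?_
  have hcx : Measurable fun y => c (x, y) := hc.comp measurable_prodMk_left
  rw [Kernel.lintegral_comp _ _ _ hcx, Kernel.lintegral_comp _ _ _ hcx.lintegral_kernel]
  refine lintegral_congr fun z => lintegral_congr fun w => ?_
  rw [Kernel.deterministic_apply, lintegral_dirac' _ hcx]

end DecodedChain

/-- The cost of a noisy map followed by a kernel and a decoder, as an expectation over the source
and the noise. -/
theorem lintegral_compProd_decode_noisyKernel {d₁ d₂ d₃ d₄ d₅ T : ℕ} {Ω : Type*}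
    [MeasurableSpace Ω] {P : Measure Ω} [IsProbabilityMeasure P]
    {X : Ω → TPath d₁ T} {ε : Ω → TPath d₂ T} (hX : Measurable X) (hε : Measurable ε)
    (hindep : IndepFun X ε P) {F : TPath d₁ T × TPath d₂ T → TPath d₃ T} (hF : Measurable F)
    (K : Kernel (TPath d₃ T) (TPath d₄ T)) [IsMarkovKernel K] {De : TPath d₄ T → TPath d₅ T}
    (hDe : Measurable De) {c : TPath d₁ T × TPath d₅ T → ℝ≥0∞} (hc : Measurable c) :
    ∫⁻ p, c p ∂((P.map X) ⊗ₘ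
        (Kernel.deterministic De hDe ∘ₖ (K ∘ₖ noisyKernel F (P.map ε)))) =
      ∫⁻ ω, ∫⁻ w, c (X ω, De w) ∂K (F (X ω, ε ω)) ∂P := by
  have : IsProbabilityMeasure (P.map X) := Measure.isProbabilityMeasure_map hX.aemeasurable
  have : IsProbabilityMeasure (P.map ε) := Measure.isProbabilityMeasure_map hε.aemeasurable
  have := isMarkovKernel_noisyKernel (γ := P.map ε) hF
  have hg := measurable_lintegral_decode (α := TPath d₁ T) K hDe hc
  have hgF : Measurable fun p : TPath d₁ T × TPath d₂ T => ∫⁻ w, c (p.1, De w) ∂K (F p) :=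
    hg.comp (measurable_fst.prodMk hF)
  rw [lintegral_compProd_deterministic_comp _ _ K hDe hc, lintegral_compProd_noisyKernel hF _ hg,
    ← (indepFun_iff_map_prod_eq_prod_map_map hX.aemeasurable hε.aemeasurable).1 hindep,
    lintegral_map hgF (hX.prodMk hε)]

/-- Affine noise with causal coefficients is a causal function of the path and the noise. -/
theorem IsCausalMap.hist_add_mul {d n T : ℕ} {μφ σφ : TPath d T → TPath n T}
    (hμφ : IsCausalMap μφ) (hσφ : IsCausalMap σφ) (t : ℕ) (x : TPath d T) (e : TPath n T) :
    hist t (fun s i => μφ (hist t x) s i + σφ (hist t x) s i * e s i) =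
      hist t (fun s i => μφ x s i + σφ x s i * e s i) := by
  have h1 := hμφ.hist_apply t x
  have h2 := hσφ.hist_apply t x
  ext r i
  by_cases h : (r : ℕ) < t
  · have h1' := congrFun (congrFun h1 r) i
    have h2' := congrFun (congrFun h2 r) i
    simp only [hist, h, if_true] at h1' h2'
    simp only [hist, h, if_true]
    exact congrArg₂ (· + ·) h1' (congrArg (· * e r i) h2')
  · simp [hist, h]

/-- Decoding a transported latent path costs at most twice the moved mass on top of the cost of
decoding the original one, if both decoded paths have norm at most one. -/
theorem lintegral_pathNorm_sub_le {d n T : ℕ} (De : TPath n T → TPath d T) (hDe : Measurable De)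
    {κ δ : Measure (TPath n T)} [IsProbabilityMeasure κ] {z : TPath n T} {c : ℝ≥0∞}
    (hκ : κ = δ + c • Measure.dirac z) (hz : pathNorm (De z) ≤ 1)
    (hae : ∀ᵐ w ∂κ, pathNorm (De w) ≤ 1) (x : TPath d T) :
    ∫⁻ w, ENNReal.ofReal (pathNorm (x - De w)) ∂κ ≤
      ENNReal.ofReal (pathNorm (x - De z)) + 2 * δ Set.univ := by
  have hm : ∀ y : TPath d T, Measurable fun w => ENNReal.ofReal (pathNorm (y - De w)) := fun y =>
    ENNReal.measurable_ofReal.comp (measurable_pathNorm.comp (hDe.const_sub y))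
  have haeδ : ∀ᵐ w ∂δ, pathNorm (De w) ≤ 1 :=
    Measure.absolutelyContinuous_of_le (hκ ▸ Measure.le_add_right le_rfl) hae
  calc ∫⁻ w, ENNReal.ofReal (pathNorm (x - De w)) ∂κ
      ≤ ∫⁻ w, (ENNReal.ofReal (pathNorm (x - De z)) +
          ENNReal.ofReal (pathNorm (De z - De w))) ∂κ := lintegral_mono fun w => by
        rw [← ENNReal.ofReal_add (pathNorm_nonneg _) (pathNorm_nonneg _)]
        exact ENNReal.ofReal_le_ofReal (pathNorm_sub_le_add _ _ _)
    _ = ENNReal.ofReal (pathNorm (x - De z)) +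
          ∫⁻ w, ENNReal.ofReal (pathNorm (De z - De w)) ∂δ := by
        rw [lintegral_add_left measurable_const, lintegral_const, measure_univ, mul_one, hκ,
          lintegral_add_measure, lintegral_smul_measure, lintegral_dirac' _ (hm _)]
        simp [pathNorm_zero]
    _ ≤ ENNReal.ofReal (pathNorm (x - De z)) + ∫⁻ _, 2 ∂δ := by
        gcongr 1
        refine lintegral_mono_ae ?_
        filter_upwards [haeδ] with w hw
        have := pathNorm_sub_le (De z) (De w)
        refine ENNReal.ofReal_le_of_le_toReal ?_
        simpa using (by linarith : pathNorm (De z - De w) ≤ 2)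
    _ = ENNReal.ofReal (pathNorm (x - De z)) + 2 * δ Set.univ := by rw [lintegral_const]

theorem CW1_length_zero {d : ℕ} (μ ν : Measure (TPath d 0)) : CW1 μ ν = 0 := by
  have hsub : { r | ∃ π : Measure (TPath d 0 × TPath d 0), IsCoupling μ ν π ∧
      IsCausalCoupling π ∧ r = ∫ p, pathNorm (p.1 - p.2) ∂π } ⊆ {0} := by
    rintro r ⟨π, -, -, rfl⟩
    simp [pathNorm]
  rcases Set.subset_singleton_iff_eq.1 hsub with h | h <;> rw [CW1, h] <;> simp

/-- The TC-VAE loss controls the causal Wasserstein distance between data and generated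
distributions: `CW₁(μ_data, μ_gen) ≤ 𝓛_rec + C·√(D_KL(μ_latent|μ_prior)/2)`. -/
theorem stmt7 (d dZ T : ℕ) {Ω : Type*} [MeasurableSpace Ω] (P : Measure Ω)
    [IsProbabilityMeasure P]
    (μφ σφ : TPath d T → TPath dZ T) (De : TPath dZ T → TPath d T)
    (hμφ : IsCausalMap μφ) (hσφ : IsCausalMap σφ) (hDe : IsCausalMap De)
    (X : Ω → TPath d T) (ε : Ω → TPath dZ T) (hX : Measurable X) (hε : Measurable ε)
    (hmom : Integrable (fun ω => pathNorm (X ω)) P)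
    (hεlaw : P.map ε = stdGaussian dZ T) (hindep : IndepFun X ε P)
    (Z : Ω → TPath dZ T) (hZ : Z = fun ω t i => μφ (X ω) t i + σφ (X ω) t i * ε ω t i)
    (Y : Ω → TPath d T) (hY : Y = fun ω => De (Z ω))
    (μprior : Measure (TPath dZ T)) [IsProbabilityMeasure μprior]
    (hrec : ∀ᵐ x ∂(P.map Y), pathNorm x ≤ 1)
    (hgen : ∀ᵐ x ∂(μprior.map De), pathNorm x ≤ 1) :
    ENNReal.ofReal (CW1 (P.map X) (μprior.map De))
      ≤ ENNReal.ofReal (∫ ω, pathNorm (X ω - Y ω) ∂P) +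
        ENNReal.ofReal (2 * (2 ^ T - 1)) * (2⁻¹ * KLDiv (P.map Z) μprior) ^ (2⁻¹ : ℝ) := by
  rcases Nat.eq_zero_or_pos T with rfl | hT
  · simp [CW1_length_zero]
  have hpow : (T : ℝ) ≤ 2 ^ T - 1 := by
    have : T + 1 ≤ 2 ^ T := Nat.lt_two_pow_self
    have : ((T + 1 : ℕ) : ℝ) ≤ ((2 ^ T : ℕ) : ℝ) := Nat.cast_le.2 this
    push_cast at this
    linarith
  have hT1 : (1 : ℝ) ≤ T := by exact_mod_cast hT
  by_cases hKL : P.map Z ≪ μprior ∧ Integrable (llr (P.map Z) μprior) (P.map Z)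
  swap
  · have hC : ENNReal.ofReal (2 * (2 ^ T - 1)) ≠ 0 := by
      rw [Ne, ENNReal.ofReal_eq_zero, not_le]
      linarith
    have hinv : (2⁻¹ : ℝ≥0∞) ≠ 0 := by simp
    rw [KLDiv, if_neg hKL, ENNReal.mul_top hinv, ENNReal.top_rpow_of_pos (by norm_num),
      ENNReal.mul_top hC]
    simp
  obtain ⟨hac, hllr⟩ := hKL
  let F : TPath d T × TPath dZ T → TPath dZ T := fun p t i => μφ p.1 t i + σφ p.1 t i * p.2 t i
  have hF : Measurable F := by
    have h1 := hμφ.1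
    have h2 := hσφ.1
    fun_prop
  have hFc : ∀ t x e, hist t (F (hist t x, e)) = hist t (F (x, e)) := fun t x e =>
    hμφ.hist_add_mul hσφ t x e
  have hZF : Z = fun ω => F (X ω, ε ω) := hZ
  have hZm : Measurable Z := hZF ▸ hF.comp (hX.prodMk hε)
  have hDem : Measurable De := hDe.1
  have hYm : Measurable Y := hY ▸ hDem.comp hZm
  have hPX : IsProbabilityMeasure (P.map X) := Measure.isProbabilityMeasure_map hX.aemeasurable
  have hPε : IsProbabilityMeasure (P.map ε) := Measure.isProbabilityMeasure_map hε.aemeasurable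
  have hPZ : IsProbabilityMeasure (P.map Z) := Measure.isProbabilityMeasure_map hZm.aemeasurable
  have hprod : (P.map X).prod (P.map ε) = P.map fun ω => (X ω, ε ω) :=
    ((indepFun_iff_map_prod_eq_prod_map_map hX.aemeasurable hε.aemeasurable).1 hindep).symm
  let J := noisyKernel F (P.map ε)
  have hJM : IsMarkovKernel J := isMarkovKernel_noisyKernel hF
  have hJμ : J ∘ₘ (P.map X) = P.map Z := by
    rw [noisyKernel_comp hF, hprod, Measure.map_map hF (hX.prodMk hε), hZF]
    rfl
  set δ := (2⁻¹ * KLDiv (P.map Z) μprior) ^ (2⁻¹ : ℝ) with hδ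
  rw [KLDiv, if_pos ⟨hac, hllr⟩] at hδ
  obtain ⟨K, D, hKM, hKμ, hKD, hDmass, hKc⟩ := exists_causal_kernel hac (δ := δ) fun A hA =>
    hδ ▸ measure_le_add_of_integral_llr hac hllr hA
  let H := Kernel.deterministic De hDem ∘ₖ (K ∘ₖ J)
  have hHc : IsCausalKernel H := hDe.isCausalKernel_deterministic.comp
    (IsCausalKernel.comp hKc (isCausalKernel_noisyKernel hF hFc))
  have hcoup : IsCoupling (P.map X) (μprior.map De) ((P.map X) ⊗ₘ H) := by
    refine ⟨Measure.fst_compProd _ _, (Measure.snd_compProd _ _).trans ?_⟩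
    rw [← Measure.comp_assoc, ← Measure.comp_assoc, hJμ, hKμ, Measure.deterministic_comp_eq_map]
  have hcm : Measurable fun p : TPath d T × TPath d T => ENNReal.ofReal (pathNorm (p.1 - p.2)) :=
    ENNReal.measurable_ofReal.comp
      (measurable_pathNorm.comp (measurable_fst.sub measurable_snd))
  have hcost : ∫⁻ p, ENNReal.ofReal (pathNorm (p.1 - p.2)) ∂((P.map X) ⊗ₘ H) =
      ∫⁻ ω, ∫⁻ w, ENNReal.ofReal (pathNorm (X ω - De w)) ∂K (Z ω) ∂P :=
    hZF ▸ lintegral_compProd_decode_noisyKernel hX hε hindep hF K hDem hcm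
  have hrecω : ∀ᵐ ω ∂P, pathNorm (De (Z ω)) ≤ 1 := by
    have := ae_of_ae_map hYm.aemeasurable hrec
    rwa [hY] at this
  have hgenω : ∀ᵐ ω ∂P, ∀ᵐ w ∂K (Z ω), pathNorm (De w) ≤ 1 := by
    have h1 := ae_of_ae_map hDem.aemeasurable hgen
    rw [← hKμ] at h1
    exact ae_of_ae_map hZm.aemeasurable (Measure.ae_ae_of_ae_comp h1)
  have hXYm : Measurable fun ω => pathNorm (X ω - Y ω) := measurable_pathNorm.comp (hX.sub hYm)
  have hXYint : Integrable (fun ω => pathNorm (X ω - Y ω)) P := by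
    refine (hmom.add (integrable_const 1)).mono' hXYm.aestronglyMeasurable ?_
    filter_upwards [hrecω] with ω hω
    rw [Real.norm_of_nonneg (pathNorm_nonneg _)]
    have h1 := pathNorm_sub_le (X ω) (Y ω)
    rw [← show Y ω = De (Z ω) from congrFun hY ω] at hω
    simp only [Pi.add_apply]
    linarith
  have hDm : Measurable fun z => D z Set.univ := D.measurable_coe MeasurableSet.univ
  have hDZm : Measurable fun ω => D (Z ω) Set.univ := hDm.comp hZm
  calc ENNReal.ofReal (CW1 (P.map X) (μprior.map De))
      ≤ ∫⁻ ω, ∫⁻ w, ENNReal.ofReal (pathNorm (X ω - De w)) ∂K (Z ω) ∂P :=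
        (ofReal_CW1_le hcoup (hHc.isCausalCoupling_compProd _)).trans hcost.le
    _ ≤ ∫⁻ ω, (ENNReal.ofReal (pathNorm (X ω - Y ω)) + 2 * D (Z ω) Set.univ) ∂P := by
        refine lintegral_mono_ae ?_
        filter_upwards [hrecω, hgenω] with ω h1 h2
        obtain ⟨c, hc⟩ := hKD (Z ω)
        rw [show Y ω = De (Z ω) from congrFun hY ω]
        exact lintegral_pathNorm_sub_le De hDem hc h1 h2 (X ω)
    _ = ENNReal.ofReal (∫ ω, pathNorm (X ω - Y ω) ∂P) + 2 * ∫⁻ z, D z Set.univ ∂(P.map Z) := by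
        rw [lintegral_add_left hXYm.ennreal_ofReal, lintegral_const_mul _ hDZm, lintegral_map hDm hZm,
          ofReal_integral_eq_lintegral_ofReal hXYint (ae_of_all _ fun ω => pathNorm_nonneg _)]
    _ ≤ ENNReal.ofReal (∫ ω, pathNorm (X ω - Y ω) ∂P) + 2 * (T * δ) := by gcongr
    _ ≤ ENNReal.ofReal (∫ ω, pathNorm (X ω - Y ω) ∂P) +
          ENNReal.ofReal (2 * (2 ^ T - 1)) * δ := by
        have h2T : (2 * T : ℝ≥0∞) = ENNReal.ofReal (2 * T) := by
          rw [ENNReal.ofReal_mul (by norm_num), ENNReal.ofReal_natCast]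
          norm_num
        rw [← mul_assoc, h2T]
        gcongr

end
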